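/- arXiv:2006.04318 — 2 statements merged into one kernel-verified Lean document; each statement's English description precedes it below -/
import Mathlib

section
/- For every n ≥ 1, the number of inversion sequences of length n avoiding the pattern 0012 equals 1 + ∑_{i=1}^{n-1} C(2i, i-1), where C(2i, i-1) is the binomial coefficient. -/
/-- `e : Fin n → ℕ` is an inversion sequence: `e i ≤ i` (0-indexed). -/
def IsInvSeq {n : ℕ} (e : Fin n → ℕ) : Prop := ∀ i : Fin n, e i ≤ (i : ℕ)

/-- `e` avoids the pattern 0012: there are no indices `i < j < k < l`
with `e i = e j < e k < e l`. -/
def Avoids0012 {n : ℕ} (e : Fin n → ℕ) : Prop :=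
  ¬ ∃ i j k l : Fin n, i < j ∧ j < k ∧ k < l ∧ e i = e j ∧ e j < e k ∧ e k < e l

/-- The set `I_n(0012)` of inversion sequences of length `n` avoiding `0012`. -/
def InvSeq0012 (n : ℕ) : Set (Fin n → ℕ) := {e | IsInvSeq e ∧ Avoids0012 e}

/-- `R(e)`: the set of values appearing more than once in `e`. -/
def repeats {n : ℕ} (e : Fin n → ℕ) : Set ℕ :=
  {m | ∃ i j : Fin n, i ≠ j ∧ e i = m ∧ e j = m}

open Classical in
/-- `srpt e = min R(e)` if `R(e) ≠ ∅`, and `n - 1` otherwise. -/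
noncomputable def srpt {n : ℕ} (e : Fin n → ℕ) : ℕ :=
  if (repeats e).Nonempty then sInf (repeats e) else n - 1

/-- The last entry of `e` (and `0` for the empty sequence). -/
def lastEntry {n : ℕ} (e : Fin n → ℕ) : ℕ :=
  if h : 0 < n then e ⟨n - 1, by omega⟩ else 0

/-- `γ(e)`: the sequence `e` with its last entry removed. -/
def gammaSeq {n : ℕ} (e : Fin n → ℕ) : Fin (n - 1) → ℕ :=
  fun i => e (Fin.castLE (Nat.sub_le n 1) i)

/-- `f n k ℓ`: the number of `e ∈ I_n(0012)` with `srpt e = k` and `last e = ℓ`. -/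
noncomputable def f (n k ℓ : ℕ) : ℕ :=
  Set.ncard {e : Fin n → ℕ | e ∈ InvSeq0012 n ∧ srpt e = k ∧ lastEntry e = ℓ}

inductive PState where
  | bad : PState
  | fresh : PState
  | st (k t : ℕ) : PState

namespace PState

/-- Transition of the automaton when the letter `l` is appended to a word of length `n`. -/
def upd (n : ℕ) : PState → ℕ → PState
  | bad, _ => bad
  | fresh, l => if l = n then fresh else if l < n then st l (n + 1) else bad
  | st k t, l => if l ≤ k then st l (if t = n then n + 1 else t)
      else if l ≤ t then st k l else bad

def run (e : ℕ → ℕ) : ℕ → PState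
  | 0 => fresh
  | n + 1 => upd n (run e n) (e n)

def Phi : ℕ → (PState → ℤ) → ℤ
  | 0, g => g fresh
  | n + 1, g => Phi n (fun s => ∑ l ∈ Finset.range (n + 1), g (upd n s l))

def Valid (n : ℕ) : PState → Prop
  | bad => True
  | fresh => True
  | st k t => k < t ∧ t ≤ n ∧ k + 2 ≤ n

theorem Phi_congr (n : ℕ) : ∀ (f g : PState → ℤ), (∀ s, Valid n s → f s = g s) →
    Phi n f = Phi n g := by
  induction n with
  | zero => intro f g h; exact h _ trivial
  | succ n ih =>
    intro f g h
    apply ih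
    intro s hs
    apply Finset.sum_congr rfl
    intro l hl
    apply h
    have hl := Finset.mem_range.1 hl
    cases s with
    | bad => trivial
    | fresh => simp only [upd]; split_ifs <;> simp [Valid]; omega
    | st k t =>
      simp only [Valid] at hs
      simp only [upd]; split_ifs <;> simp [Valid] <;> omega

theorem Phi_add (n : ℕ) : ∀ (f g : PState → ℤ), Phi n (fun s => f s + g s) = Phi n f + Phi n g := by
  induction n with
  | zero => intro f g; rfl
  | succ n ih => intro f g; simp only [Phi, Finset.sum_add_distrib, ih]

theorem Phi_zero (n : ℕ) : Phi n (fun _ => 0) = 0 := by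
  induction n with
  | zero => rfl
  | succ n ih => simp only [Phi, Finset.sum_const_zero, ih]

theorem Phi_sum (n : ℕ) (s : Finset ℕ) (f : ℕ → PState → ℤ) :
    Phi n (fun x => ∑ i ∈ s, f i x) = ∑ i ∈ s, Phi n (f i) := by
  induction s using Finset.induction_on with
  | empty => simp [Phi_zero]
  | insert a s ha ih => simp only [Finset.sum_insert ha, Phi_add, ih]

def indF : PState → ℤ
  | fresh => 1
  | _ => 0

def ind (n k l : ℕ) : PState → ℤ
  | st k' t => if k' = k ∧ (l ≤ t ∨ t = n) then 1 else 0
  | _ => 0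

def indOK : PState → ℤ
  | bad => 0
  | _ => 1

theorem Phi_indF (n : ℕ) : Phi n indF = 1 := by
  induction n with
  | zero => rfl
  | succ n ih =>
    rw [Phi, ← ih]
    apply Phi_congr
    intro s _
    cases s with
    | bad => simp [upd, indF]
    | fresh =>
      rw [Finset.sum_range_succ, Finset.sum_eq_zero]
      · simp [upd, indF]
      · intro l hl
        have := Finset.mem_range.1 hl
        simp [upd, indF, this, this.ne]
    | st k t =>
      apply Finset.sum_eq_zero
      intro l _
      simp only [upd]
      split_ifs <;> rfl

def P (n k l : ℕ) : ℤ := Phi n (ind n k l)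

theorem P_low (n k l : ℕ) (h : l ≤ k + 1) : P n k l = P n k (k + 1) := by
  apply Phi_congr
  intro s hs
  cases s with
  | bad => rfl
  | fresh => rfl
  | st k' t =>
    simp only [Valid] at hs
    simp only [ind]
    congr 1
    apply propext
    constructor <;> rintro ⟨h1, h2⟩ <;> exact ⟨h1, by omega⟩

theorem P_high (n k l : ℕ) (h : n ≤ l) : P n k l = P n k n := by
  apply Phi_congr
  intro s hs
  cases s with
  | bad => rfl
  | fresh => rfl
  | st k' t =>
    simp only [Valid] at hs
    simp only [ind]
    congr 1
    apply propext
    constructor <;> rintro ⟨h1, h2⟩ <;> exact ⟨h1, by omega⟩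

theorem P_big (n k l : ℕ) (h : n ≤ k + 1) : P n k l = 0 := by
  rw [← Phi_zero n]
  apply Phi_congr
  intro s hs
  cases s with
  | bad => rfl
  | fresh => rfl
  | st k' t =>
    simp only [Valid] at hs
    simp only [ind]
    rw [if_neg]
    omega

theorem P_one : P 1 0 0 = 0 ∧ P 1 0 1 = 0 := by
  constructor <;> simp [P, Phi, upd, ind]

theorem P_rec (n k l : ℕ) (hk : k < n) (hl : k < l) :
    P (n + 1) k l = 1 + ∑ m ∈ Finset.Ico l (n + 1), P n k m + ∑ j ∈ Finset.Ico k n, P n j l := by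
  simp only [P]
  rw [← Phi_indF n, ← Phi_sum, ← Phi_sum, ← Phi_add, ← Phi_add, Phi]
  apply Phi_congr
  intro s hs
  cases s with
  | bad => simp [upd, ind, indF]
  | fresh =>
    simp only [ind, indF, Finset.sum_const_zero, add_zero]
    rw [Finset.sum_eq_single k]
    · simp [upd, ind, hk, hk.ne]
    · intro b hb hbk
      simp only [upd]; split_ifs <;> simp [ind, hbk]
    · intro h; simp at h; omega
  | st a t =>
    simp only [Valid] at hs
    have e1 : ∀ b ∈ Finset.range (n + 1), ind (n + 1) k l (upd n (st a t) b)
        = (if a = k then (if l ≤ b ∧ b ≤ t then 1 else 0) else 0)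
          + (if b = k then (if k ≤ a ∧ (l ≤ t ∨ t = n) then 1 else 0) else 0) := by
      intro b hb
      have hb := Finset.mem_range.1 hb
      simp only [upd]
      split_ifs <;> simp only [ind, or_true, and_true] <;> (try split_ifs) <;> first | rfl | (exfalso; omega)
    rw [Finset.sum_congr rfl e1, Finset.sum_add_distrib]
    simp only [indF, zero_add]
    congr 1
    · simp only [ind]
      by_cases hak : a = k
      · simp only [hak, true_and, if_true]
        rw [← Finset.sum_filter, ← Finset.sum_filter]
        congr 1
        ext b
        simp only [Finset.mem_filter, Finset.mem_range, Finset.mem_Ico]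
        omega
      · simp [hak]
    · rw [Finset.sum_ite_eq' (Finset.range (n + 1)) k, if_pos (by simp; omega)]
      simp only [ind]
      by_cases h : k ≤ a
      · rw [Finset.sum_eq_single a]
        · simp [h]
        · intro b _ hb; rw [if_neg]; intro h'; exact hb h'.1.symm
        · intro h'; simp at h'; omega
      · rw [if_neg (by omega), Finset.sum_eq_zero]
        intro b hb
        have := Finset.mem_Ico.1 hb
        rw [if_neg]; omega

theorem total_P (n : ℕ) : Phi n indOK = 1 + ∑ k ∈ Finset.range n, P n k (k + 1) := by
  rw [Finset.sum_congr rfl (fun k _ => (P_low n k 0 (by omega)).symm)]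
  simp only [P]
  rw [← Phi_indF n, ← Phi_sum, ← Phi_add]
  apply Phi_congr
  intro s hs
  cases s with
  | bad => simp [ind, indF, indOK]
  | fresh => simp [ind, indF, indOK]
  | st a t =>
    simp only [Valid] at hs
    simp only [ind, indF, indOK]
    rw [Finset.sum_eq_single a]
    · simp
    · intro b _ hb; rw [if_neg]; intro h'; exact hb h'.1.symm
    · intro h'; simp at h'; omega

theorem P_shift (n : ℕ) : ∀ k l : ℕ, P (n + 1) (k + 1) (l + 1) = P n k l := by
  induction n with
  | zero => intro k l; rw [P_big _ _ _ (by omega), P_big _ _ _ (by omega)]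
  | succ n ih =>
    have key : ∀ k l : ℕ, k < l → P (n + 1 + 1) (k + 1) (l + 1) = P (n + 1) k l := by
      intro k l hl
      rcases Nat.lt_or_ge k n with h | h
      · rw [P_rec (n + 1) (k + 1) (l + 1) (by omega) (by omega), P_rec n k l h hl]
        rw [← Finset.sum_Ico_add' (fun m => P (n + 1) (k + 1) m) l (n + 1) 1,
          ← Finset.sum_Ico_add' (fun m => P (n + 1) m (l + 1)) k n 1]
        simp only [ih]
      · rw [P_big _ _ _ (by omega), P_big _ _ _ (by omega)]
    intro k l
    rcases Nat.lt_or_ge k l with h | h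
    · exact key k l h
    · rw [P_low _ _ _ (by omega), P_low (n + 1) k l (by omega), key k (k + 1) (by omega)]

theorem P_shift' (k n l : ℕ) : P (n + k) k (l + k) = P n 0 l := by
  induction k with
  | zero => rfl
  | succ k ih => exact (P_shift (n + k) k (l + k)).trans ih

/-- The numbers `Q N d`. -/
def Q (N d : ℕ) : ℤ := P N 0 d

def S (N d : ℕ) : ℤ := ∑ j ∈ Finset.range N, P N j d

theorem S_succ (N d : ℕ) : S (N + 1) (d + 1) = Q (N + 1) (d + 1) + S N d := by
  simp only [S, Finset.sum_range_succ', P_shift, Q]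
  ring

theorem S_zero (N : ℕ) : S N 0 = S N 1 := by
  apply Finset.sum_congr rfl
  intro k _
  rw [P_low _ _ _ (by omega), P_low _ _ 1 (by omega)]

theorem Q_rec (N d : ℕ) (hN : 1 ≤ N) (hd : 1 ≤ d) :
    Q (N + 1) d = 1 + ∑ m ∈ Finset.Ico d (N + 1), Q N m + S N d := by
  simp only [Q, S, P_rec N 0 d hN hd, Finset.range_eq_Ico]

theorem Q_diff (N d : ℕ) (hN : 1 ≤ N) (hd : 1 ≤ d) (h : d ≤ N) :
    Q (N + 1) d - Q (N + 1) (d + 1) = Q N d + S N d - S N (d + 1) := by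
  rw [Q_rec N d hN hd, Q_rec N (d + 1) hN (by omega), Finset.sum_eq_sum_Ico_succ_bot (by omega)]
  ring

theorem L1 (N d : ℕ) (hd : 2 ≤ d) (h : d ≤ N) :
    Q (N + 1) d - Q (N + 1) (d + 1) - Q N d + Q N (d + 1) = Q N (d - 1) - Q (N - 1) (d - 1) := by
  obtain ⟨M, rfl⟩ : ∃ M, N = M + 1 := ⟨N - 1, by omega⟩
  obtain ⟨c, rfl⟩ : ∃ c, d = c + 1 := ⟨d - 1, by omega⟩
  have h1 := Q_diff (M + 1) (c + 1) (by omega) (by omega) h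
  have h2 := Q_diff M c (by omega) (by omega) (by omega)
  rw [S_succ, S_succ] at h1
  simp only [Nat.add_sub_cancel]
  linarith

theorem L2 (N : ℕ) (hN : 1 ≤ N) :
    Q (N + 1) 1 - Q (N + 1) 2 - Q N 1 + Q N 2 = Q N 1 := by
  obtain ⟨M, rfl⟩ : ∃ M, N = M + 1 := ⟨N - 1, by omega⟩
  have h1 := Q_diff (M + 1) 1 (by omega) (by omega) hN
  rw [S_succ M 0, S_succ M 1, S_zero] at h1
  linarith

theorem Q_one (d : ℕ) : Q 1 d = 0 := P_big _ _ _ (by omega)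

theorem S_diag (N : ℕ) : S (N + 1) (N + 1) = 2 ^ N - 1 ∧ Q (N + 2) (N + 2) = 2 ^ N := by
  induction N with
  | zero =>
    have h : S 1 1 = 0 := by
      simp only [S, Finset.sum_range_one]; exact Q_one 1
    refine ⟨by simpa using h, ?_⟩
    rw [Q_rec 1 2 (by omega) (by omega), S_succ, S, Q_one]; simp
  | succ N ih =>
    have h : S (N + 1 + 1) (N + 1 + 1) = 2 ^ (N + 1) - 1 := by
      rw [S_succ, ih.1, ih.2]; ring
    refine ⟨h, ?_⟩
    have h2 : S (N + 1 + 1) (N + 1 + 2) = S (N + 1 + 1) (N + 1 + 1) := by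
      apply Finset.sum_congr rfl
      intro k _
      rw [P_high _ _ _ (by omega)]
    rw [Q_rec (N + 2) (N + 1 + 2) (by omega) (by omega)]
    have h3 : S (N + 2) (N + 1 + 2) = 2 ^ (N + 1) - 1 := by rw [← h, ← h2]
    rw [h3]
    simp

/-- `g s (m+2) = C(s,m) + C(s,m-2) + ...` -/
def g (s : ℕ) : ℕ → ℤ
  | 0 => 0
  | 1 => 0
  | m + 2 => (s.choose m : ℤ) + g s m

theorem g_pascal (s m : ℕ) : g (s + 1) (m + 1) = g s (m + 1) + g s m := by
  induction m using Nat.twoStepInduction with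
  | zero => simp [g]
  | one => simp [g]
  | more m ih _ =>
    have e : g (s + 1) (m + 2 + 1) = ((s + 1).choose (m + 1) : ℤ) + g (s + 1) (m + 1) := rfl
    have e2 : g s (m + 2 + 1) = (s.choose (m + 1) : ℤ) + g s (m + 1) := rfl
    have e3 : g s (m + 2) = (s.choose m : ℤ) + g s m := rfl
    rw [e, e2, e3, ih, Nat.choose_succ_succ]
    push_cast
    ring

theorem g_sum (s m : ℕ) : g s m + g s (m + 1) = ∑ i ∈ Finset.range m, (s.choose i : ℤ) := by
  induction m with
  | zero => simp [g]
  | succ m ih =>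
    have e3 : g s (m + 2) = (s.choose m : ℤ) + g s m := rfl
    rw [Finset.sum_range_succ, ← ih, e3]
    ring

theorem g_diag (s : ℕ) : g (s + 1) (s + 3) = 2 ^ s := by
  rw [g_pascal s (s + 2), add_comm, g_sum s (s + 2), Finset.sum_range_succ, Nat.choose_succ_self]
  have := Nat.sum_range_choose s
  simp only [Nat.cast_zero, add_zero]
  exact_mod_cast this

def rho (N d : ℕ) : ℤ := g (2 * N - d - 2) N - g (2 * N - d - 2) (N - d - 2)

theorem rho_pascal (N d : ℕ) (hN : 2 ≤ N) (hd : 1 ≤ d) (h : d ≤ N) :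
    rho (N + 1) d = rho (N + 1) (d + 1) + rho N (d - 1) := by
  simp only [rho]
  obtain ⟨s, hs⟩ : ∃ s, s = 2 * N - d - 1 := ⟨_, rfl⟩
  rw [show 2 * (N + 1) - d - 2 = s + 1 by omega, show 2 * (N + 1) - (d + 1) - 2 = s by omega,
    show 2 * N - (d - 1) - 2 = s by omega, g_pascal]
  rcases Nat.lt_or_ge d (N - 1) with h' | h'
  · obtain ⟨m, hm⟩ : ∃ m, N + 1 - d - 2 = m + 1 := ⟨N - d - 2, by omega⟩
    rw [hm, g_pascal, show N + 1 - (d + 1) - 2 = m by omega, show N - (d - 1) - 2 = m + 1 by omega]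
    ring
  · rw [show N + 1 - d - 2 = 0 by omega, show N + 1 - (d + 1) - 2 = 0 by omega,
      show N - (d - 1) - 2 = 0 by omega]
    simp only [g]
    ring

theorem rho_zero (N : ℕ) (hN : 2 ≤ N) : rho N 0 = ((2 * N - 2).choose (N - 2) : ℤ) := by
  obtain ⟨M, rfl⟩ : ∃ M, N = M + 2 := ⟨N - 2, by omega⟩
  simp only [rho]
  have e3 : ∀ s, g s (M + 2) = (s.choose M : ℤ) + g s M := fun _ => rfl
  rw [show M + 2 - 0 - 2 = M by omega, e3]
  simp

theorem rho_refl (N : ℕ) (hN : 2 ≤ N) : rho (N + 1) 0 = rho (N + 1) 1 + rho N 0 := by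
  obtain ⟨M, rfl⟩ : ∃ M, N = M + 2 := ⟨N - 2, by omega⟩
  simp only [rho]
  rw [show 2 * (M + 2 + 1) - 0 - 2 = 2 * M + 2 + 1 + 1 by omega,
    show 2 * (M + 2 + 1) - 1 - 2 = 2 * M + 2 + 1 by omega,
    show 2 * (M + 2) - 0 - 2 = 2 * M + 2 by omega,
    show M + 2 + 1 - 0 - 2 = M + 1 by omega, show M + 2 + 1 - 1 - 2 = M by omega,
    show M + 2 - 0 - 2 = M by omega, g_pascal (2 * M + 2 + 1) (M + 2),
    g_pascal (2 * M + 2 + 1) M, g_pascal (2 * M + 2) (M + 1), g_pascal (2 * M + 2) M]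
  ring

theorem main_Q (N : ℕ) : (∀ d, 1 ≤ d → d ≤ N + 2 → Q (N + 2) d - Q (N + 1) d = rho (N + 2) d) ∧
    Q (N + 2) 1 = rho (N + 2) 0 := by
  induction N with
  | zero =>
    have h2 : Q 2 2 = 1 := (S_diag 0).2
    have h1 : Q 2 1 = 1 := by
      have := L2 1 le_rfl
      simp only [Q_one] at this
      have h : Q (1 + 1) 2 = 1 := h2
      rw [h] at this
      have h' : Q 2 1 - 1 - 0 + 0 = 0 := this
      linarith
    constructor
    · intro d hd hd'
      simp only [Nat.zero_add] at *
      interval_cases d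
      · rw [h1, Q_one]; decide
      · rw [h2, Q_one]; decide
    · simp only [Nat.zero_add]; rw [h1]; decide
  | succ N ih =>
    have hR : ∀ c d, d + c = N + 3 → 1 ≤ d → Q (N + 3) d - Q (N + 2) d = rho (N + 3) d := by
      intro c
      induction c with
      | zero =>
        intro d hd _
        obtain rfl : d = N + 3 := by omega
        have e1 : Q (N + 3) (N + 3) = 2 ^ (N + 1) := (S_diag (N + 1)).2
        have e2 : Q (N + 2) (N + 3) = 2 ^ N := by
          rw [← (S_diag N).2]; exact P_high _ _ _ (by omega)
        rw [e1, e2, rho, show 2 * (N + 3) - (N + 3) - 2 = N + 1 by omega,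
          show N + 3 - (N + 3) - 2 = 0 by omega, g_diag]
        simp only [g]; ring
      | succ c ihc =>
        intro d hd hd1
        have a1 := ihc (d + 1) (by omega) (by omega)
        have a2 := rho_pascal (N + 2) d (by omega) hd1 (by omega)
        have a2 : rho (N + 3) d = rho (N + 3) (d + 1) + rho (N + 2) (d - 1) := a2
        rcases Nat.lt_or_ge 1 d with h | h
        · have a3 : Q (N + 3) d - Q (N + 3) (d + 1) - Q (N + 2) d + Q (N + 2) (d + 1)
              = Q (N + 2) (d - 1) - Q (N + 1) (d - 1) := L1 (N + 2) d h (by omega)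
          have a4 := ih.1 (d - 1) (by omega) (by omega)
          linarith
        · obtain rfl : d = 1 := by omega
          have a3 : Q (N + 3) 1 - Q (N + 3) 2 - Q (N + 2) 1 + Q (N + 2) 2
              = Q (N + 2) 1 := L2 (N + 2) (by omega)
          have a4 := ih.2
          simp only [Nat.sub_self, Nat.reduceAdd] at *
          linarith
    refine ⟨fun d h1 h2 => hR (N + 3 - d) d (by omega) h1, ?_⟩
    have b1 := hR (N + 2) 1 (by omega) le_rfl
    have b2 : rho (N + 3) 0 = rho (N + 3) 1 + rho (N + 2) 0 := rho_refl (N + 2) (by omega)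
    have b3 := ih.2
    have : Q (N + 3) 1 = rho (N + 3) 0 := by linarith
    exact this

theorem Q_closed (i : ℕ) (hi : 1 ≤ i) : Q (i + 1) 1 = ((2 * i).choose (i - 1) : ℤ) := by
  obtain ⟨N, rfl⟩ : ∃ N, i = N + 1 := ⟨i - 1, by omega⟩
  have := (main_Q N).2
  rw [rho_zero _ (by omega)] at this
  exact this

theorem total_closed (n : ℕ) (hn : 1 ≤ n) :
    Phi n indOK = 1 + ∑ i ∈ Finset.Icc 1 (n - 1), ((2 * i).choose (i - 1) : ℤ) := by
  obtain ⟨m, rfl⟩ : ∃ m, n = m + 1 := ⟨n - 1, by omega⟩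
  rw [total_P, ← Finset.sum_range_reflect]
  congr 1
  have : ∀ j ∈ Finset.range (m + 1), P (m + 1) (m + 1 - 1 - j) (m + 1 - 1 - j + 1) = Q (j + 1) 1 := by
    intro j hj
    have hj := Finset.mem_range.1 hj
    rw [Q, ← P_shift' (m - j)]
    congr 1 <;> omega
  rw [Finset.sum_congr rfl this, Finset.sum_range_succ', Q_one, add_zero]
  rw [Nat.add_sub_cancel, Finset.range_eq_Ico, Finset.sum_Ico_add' (fun i => Q (i + 1) 1) 0 m 1]
  apply Finset.sum_congr
  · ext x; simp only [Finset.mem_Ico, Finset.mem_Icc]; omega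
  · intro i hi
    exact Q_closed i (Finset.mem_Icc.1 hi).1

end PState

namespace PState

def SInv (n : ℕ) (e : ℕ → ℕ) : Prop := ∀ i, i < n → e i ≤ i

def SAv (n : ℕ) (e : ℕ → ℕ) : Prop :=
  ∀ i j a b, i < j → j < a → a < b → b < n → e i = e j → e j < e a → ¬ e a < e b

def Sem (n : ℕ) (e : ℕ → ℕ) : PState → Prop
  | bad => ¬ (SInv n e ∧ SAv n e)
  | fresh => ∀ i, i < n → e i = i
  | st k t => SInv n e ∧ SAv n e ∧ k < t ∧ t ≤ n ∧ (∀ v, v ≤ k → ∃ i, i < n ∧ e i = v) ∧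
      (∃ i j, i < j ∧ j < n ∧ e i = k ∧ e j = k) ∧
      (∀ i j, i < j → j < n → e i = e j → k ≤ e i) ∧
      (t < n → ∃ i j a, i < j ∧ j < a ∧ a < n ∧ e i = e j ∧ e j < e a ∧ e a = t) ∧
      (∀ i j a, i < j → j < a → a < n → e i = e j → e j < e a → t ≤ e a)

theorem sem_run (e : ℕ → ℕ) (n : ℕ) (h : ∀ i, i < n → e i ≤ i) : Sem n e (run e n) := by
  induction n with
  | zero => intro i hi; omega
  | succ n ih =>
    have ih := ih (fun i hi => h i (by omega))
    have hen := h n (by omega)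
    rw [run]
    rcases hs : run e n with _ | _ | ⟨k, t⟩
    · rw [hs] at ih
      simp only [upd, Sem] at *
      rintro ⟨h1, h2⟩
      exact ih ⟨fun i hi => h1 i (by omega), fun i j a b q1 q2 q3 q4 =>
        h2 i j a b q1 q2 q3 (by omega)⟩
    · rw [hs] at ih
      simp only [Sem] at ih
      simp only [upd]
      split_ifs with c1 c2
      · intro i hi
        rcases Nat.lt_or_ge i n with h' | h'
        · exact ih i h'
        · obtain rfl : i = n := by omega
          exact c1
      · have inj : ∀ i j, i < j → j < n + 1 → e i = e j → j = n ∧ i = e n := by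
          intro i j h1 h2 h3
          have := ih i (by omega)
          rcases Nat.lt_or_ge j n with h' | h'
          · have := ih j h'; omega
          · obtain rfl : j = n := by omega
            exact ⟨rfl, by omega⟩
        refine ⟨h, ?_, by omega, le_rfl, ?_, ⟨e n, n, c2, by omega, ih _ c2, rfl⟩, ?_, by omega, ?_⟩
        · intro i j a b q1 q2 q3 q4 q5
          have := inj i j q1 (by omega) q5
          omega
        · intro v hv
          exact ⟨v, by omega, ih v (by omega)⟩
        · intro i j q1 q2 q3
          obtain ⟨rfl, _⟩ := inj i j q1 q2 q3
          omega
        · intro i j a q1 q2 q3 q5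
          have := inj i j q1 (by omega) q5
          omega
      · omega
    · rw [hs] at ih
      obtain ⟨h1, h2, hkt, htn, happ, ⟨p, q, hpq, hq, hp1, hq1⟩, hrep, ht, htmin⟩ := ih
      simp only [upd]
      have av : e n ≤ t → SAv (n + 1) e := by
        intro hle i j a b q1 q2 q3 q4 q5 q6 q7
        rcases Nat.lt_or_ge b n with h' | h'
        · exact h2 i j a b q1 q2 q3 h' q5 q6 q7
        · obtain rfl : b = n := by omega
          have := htmin i j a q1 q2 q3 q5 q6
          omega
      split_ifs with c1 c2 c3
      · -- t = n
        refine ⟨h, av (by omega), by omega, le_rfl, ?_, ?_, ?_, by omega, ?_⟩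
        · intro v hv
          obtain ⟨i, hi, hi'⟩ := happ v (by omega)
          exact ⟨i, by omega, hi'⟩
        · obtain ⟨i, hi, hi'⟩ := happ (e n) c1
          exact ⟨i, n, hi, by omega, hi', rfl⟩
        · intro i j q1 q2 q3
          rcases Nat.lt_or_ge j n with h' | h'
          · have := hrep i j q1 h' q3; omega
          · obtain rfl : j = n := by omega
            omega
        · intro i j a q1 q2 q3 q5 q6
          exfalso
          rcases Nat.lt_or_ge a n with h' | h'
          · have := htmin i j a q1 q2 h' q5 q6
            have := h a q3
            omega
          · obtain rfl : a = n := by omega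
            have := hrep i j q1 q2 q5
            omega
      · refine ⟨h, av (by omega), by omega, by omega, ?_, ?_, ?_, ?_, ?_⟩
        · intro v hv
          obtain ⟨i, hi, hi'⟩ := happ v (by omega)
          exact ⟨i, by omega, hi'⟩
        · obtain ⟨i, hi, hi'⟩ := happ (e n) c1
          exact ⟨i, n, hi, by omega, hi', rfl⟩
        · intro i j q1 q2 q3
          rcases Nat.lt_or_ge j n with h' | h'
          · have := hrep i j q1 h' q3; omega
          · obtain rfl : j = n := by omega
            omega
        · intro _
          obtain ⟨i, j, a, r1, r2, r3, r4⟩ := ht (by omega)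
          exact ⟨i, j, a, r1, r2, by omega, r4⟩
        · intro i j a q1 q2 q3 q5 q6
          rcases Nat.lt_or_ge a n with h' | h'
          · exact htmin i j a q1 q2 h' q5 q6
          · obtain rfl : a = n := by omega
            have := hrep i j q1 q2 q5
            omega
      · refine ⟨h, av (by omega), by omega, by omega, ?_, ⟨p, q, hpq, by omega, hp1, hq1⟩, ?_, ?_, ?_⟩
        · intro v hv
          obtain ⟨i, hi, hi'⟩ := happ v (by omega)
          exact ⟨i, by omega, hi'⟩
        · intro i j q1 q2 q3
          rcases Nat.lt_or_ge j n with h' | h'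
          · exact hrep i j q1 h' q3
          · obtain rfl : j = n := by omega
            omega
        · intro _
          exact ⟨p, q, n, hpq, hq, by omega, by omega, by omega, rfl⟩
        · intro i j a q1 q2 q3 q5 q6
          rcases Nat.lt_or_ge a n with h' | h'
          · have := htmin i j a q1 q2 h' q5 q6
            omega
          · obtain rfl : a = n := by omega
            exact le_rfl
      · rintro ⟨_, hav⟩
        obtain ⟨i, j, a, r1, r2, r3, r4, r5, r6⟩ := ht (by omega)
        exact hav i j a n r1 r2 r3 (by omega) r4 r5 (by omega)

theorem SAv_fresh (n : ℕ) (e : ℕ → ℕ) (h : ∀ i, i < n → e i = i) : SAv n e := by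
  intro i j a b q1 q2 q3 q4 q5
  have := h i (by omega)
  have := h j (by omega)
  omega

theorem indOK_run (e : ℕ → ℕ) (n : ℕ) (h : ∀ i, i < n → e i ≤ i) [Decidable (SAv n e)] :
    indOK (run e n) = if SAv n e then 1 else 0 := by
  have := sem_run e n h
  rcases hs : run e n with _ | _ | ⟨k, t⟩
  · rw [hs] at this
    rw [if_neg (fun h' => this ⟨h, h'⟩)]; rfl
  · rw [hs] at this
    rw [if_pos (SAv_fresh n e this)]; rfl
  · rw [hs] at this
    rw [if_pos this.2.1]; rfl

def ext {n : ℕ} (e : Fin n → ℕ) (i : ℕ) : ℕ := if h : i < n then e ⟨i, h⟩ else 0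

theorem run_congr (e e' : ℕ → ℕ) (n : ℕ) (h : ∀ i, i < n → e i = e' i) : run e n = run e' n := by
  induction n with
  | zero => rfl
  | succ n ih => rw [run, run, ih (fun i hi => h i (by omega)), h n (by omega)]

def X (n : ℕ) : Finset (Fin n → ℕ) := Fintype.piFinset (fun i => Finset.range ((i : ℕ) + 1))

theorem mem_X {n : ℕ} (e : Fin n → ℕ) : e ∈ X n ↔ IsInvSeq e := by
  simp [X, IsInvSeq, Nat.lt_succ_iff]

theorem sum_X (n : ℕ) : ∀ w : PState → ℤ, ∑ e ∈ X n, w (run (ext e) n) = Phi n w := by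
  induction n with
  | zero => intro w; simp [X, run, Phi]
  | succ n ih =>
    intro w
    rw [Phi, ← ih, Finset.sum_sigma']
    refine Finset.sum_bij' (fun e _ => ⟨Fin.init e, e (Fin.last n)⟩)
      (fun p _ => Fin.snoc (α := fun _ => ℕ) p.1 p.2) ?_ ?_ ?_ ?_ ?_
    · intro e he
      rw [mem_X] at he
      simp only [Finset.mem_sigma, mem_X, Finset.mem_range]
      refine ⟨fun i => ?_, ?_⟩
      · exact he i.castSucc
      · exact Nat.lt_succ_of_le (he (Fin.last n))
    · intro p hp
      simp only [Finset.mem_sigma, mem_X, Finset.mem_range] at hp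
      rw [mem_X]
      intro i
      induction i using Fin.lastCases with
      | last => simp; omega
      | cast i => simpa using hp.1 i
    · intro e _; simp
    · intro p _; simp
    · intro e _
      rw [run]
      congr 2
      · apply run_congr
        intro i hi
        simp only [ext, hi, show i < n + 1 by omega, dif_pos]
        rfl
      · simp only [ext, show n < n + 1 by omega, dif_pos]
        rfl

theorem av_iff {n : ℕ} (e : Fin n → ℕ) : Avoids0012 e ↔ SAv n (ext e) := by
  constructor
  · intro h i j a b q1 q2 q3 q4 q5 q6 q7
    simp only [ext, show i < n by omega, show j < n by omega, show a < n by omega, q4, dif_pos]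
      at q5 q6 q7
    exact h ⟨⟨i, by omega⟩, ⟨j, by omega⟩, ⟨a, by omega⟩, ⟨b, q4⟩, q1, q2, q3, q5, q6, q7⟩
  · rintro h ⟨i, j, a, b, q1, q2, q3, q5, q6, q7⟩
    refine h i j a b q1 q2 q3 b.2 ?_ ?_ ?_ <;> simpa [ext]

open Classical in
theorem ncard_eq (n : ℕ) : ((InvSeq0012 n).ncard : ℤ) = Phi n indOK := by
  have hset : InvSeq0012 n = ((X n).filter (fun e => SAv n (ext e)) : Finset (Fin n → ℕ)) := by
    ext e
    simp [InvSeq0012, mem_X, av_iff]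
  rw [hset, Set.ncard_coe_finset, Finset.card_filter, ← sum_X]
  push_cast
  apply Finset.sum_congr rfl
  intro e he
  rw [mem_X] at he
  rw [indOK_run]
  intro i hi
  simp only [ext, hi, dif_pos]
  exact he ⟨i, hi⟩

end PState

/-- For every `n ≥ 1`, `|I_n(0012)| = 1 + ∑_{i=1}^{n-1} C(2i, i-1)`. -/
theorem stmt0 (n : ℕ) (hn : 1 ≤ n) :
    (InvSeq0012 n).ncard =
      1 + ∑ i ∈ Finset.Icc 1 (n - 1), Nat.choose (2 * i) (i - 1) := by
  have h := (PState.ncard_eq n).trans (PState.total_closed n hn)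
  exact_mod_cast h
end

section
/- For every n ≥ 2 and all k, ℓ with 0 ≤ k < ℓ ≤ n−2, f_n(k, ℓ) = ∑_{k'=k}^{ℓ} f_{n−1}(k', ℓ) + ∑_{ℓ'=ℓ}^{n−2} f_{n−1}(k, ℓ'). -/
/-- Restriction of a sequence on the naturals to its first `n` entries. -/
def mkSeq (n : ℕ) (a : ℕ → ℕ) : Fin n → ℕ := fun i => a i

theorem exists_mkSeq {n : ℕ} (e : Fin n → ℕ) : ∃ a, e = mkSeq n a :=
  ⟨fun i => if h : i < n then e ⟨i, h⟩ else 0, by ext i; simp [mkSeq]⟩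

theorem mkSeq_congr {n : ℕ} {a b : ℕ → ℕ} : mkSeq n a = mkSeq n b ↔ ∀ i < n, a i = b i := by
  constructor
  · intro h i hi
    exact congrFun h ⟨i, hi⟩
  · intro h
    ext i
    exact h i i.2

/-- Membership in `I_n(0012)` for sequences on the naturals. -/
def Good (n : ℕ) (a : ℕ → ℕ) : Prop :=
  (∀ i < n, a i ≤ i) ∧
    ∀ i j k l, i < j → j < k → k < l → l < n → a i = a j → a j < a k → ¬ a k < a l

theorem good_iff {n : ℕ} {a : ℕ → ℕ} : mkSeq n a ∈ InvSeq0012 n ↔ Good n a := by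
  constructor
  · rintro ⟨h1, h2⟩
    refine ⟨fun i hi => h1 ⟨i, hi⟩, fun i j k l hij hjk hkl hl e1 e2 e3 => h2 ?_⟩
    exact ⟨⟨i, by omega⟩, ⟨j, by omega⟩, ⟨k, by omega⟩, ⟨l, hl⟩, hij, hjk, hkl, e1, e2, e3⟩
  · rintro ⟨h1, h2⟩
    refine ⟨fun i => h1 i i.2, ?_⟩
    rintro ⟨i, j, k, l, hij, hjk, hkl, e1, e2, e3⟩
    exact h2 i j k l hij hjk hkl l.2 e1 e2 e3

/-- `srpt = k` for sequences on the naturals, of length `n + 1`. -/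
def Srp (n : ℕ) (a : ℕ → ℕ) (k : ℕ) : Prop :=
  ((∃ i j, i < j ∧ j < n + 1 ∧ a i = k ∧ a j = k) ∨
    (k = n ∧ ∀ i j, i < j → j < n + 1 → a i ≠ a j)) ∧
    ∀ i j, i < j → j < n + 1 → a i = a j → k ≤ a i

theorem mem_repeats {n : ℕ} {a : ℕ → ℕ} {m : ℕ} :
    m ∈ repeats (mkSeq n a) ↔ ∃ i j, i < j ∧ j < n ∧ a i = m ∧ a j = m := by
  constructor
  · rintro ⟨i, j, hij, h1, h2⟩
    rcases lt_or_gt_of_ne hij with h | h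
    · exact ⟨i, j, h, j.2, h1, h2⟩
    · exact ⟨j, i, h, i.2, h2, h1⟩
  · rintro ⟨i, j, hij, hj, h1, h2⟩
    refine ⟨⟨i, by omega⟩, ⟨j, hj⟩, ?_, h1, h2⟩
    intro h
    have := congrArg Fin.val h
    simp at this
    omega

theorem srp_srpt (n : ℕ) (a : ℕ → ℕ) : Srp n a (srpt (mkSeq (n+1) a)) := by
  unfold srpt
  split_ifs with h
  · have h1 := Nat.sInf_mem h
    refine ⟨Or.inl (mem_repeats.1 h1), fun i j hij hj e => Nat.sInf_le ?_⟩
    exact mem_repeats.2 ⟨i, j, hij, hj, rfl, e.symm⟩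
  · have h2 : ∀ i j, i < j → j < n + 1 → a i ≠ a j := fun i j hij hj e =>
      h ⟨a i, mem_repeats.2 ⟨i, j, hij, hj, rfl, e.symm⟩⟩
    exact ⟨Or.inr ⟨by simp, h2⟩, fun i j hij hj e => absurd e (h2 i j hij hj)⟩

theorem srp_unique {n : ℕ} {a : ℕ → ℕ} {k k' : ℕ} (h : Srp n a k) (h' : Srp n a k') : k = k' := by
  obtain ⟨h1, h2⟩ := h
  obtain ⟨h1', h2'⟩ := h'
  rcases h1 with ⟨i, j, a1, a2, a3, a4⟩ | ⟨a1, a2⟩ <;>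
  rcases h1' with ⟨i', j', b1, b2, b3, b4⟩ | ⟨b1, b2⟩
  · have := h2 i' j' b1 b2 (by omega)
    have := h2' i j a1 a2 (by omega)
    omega
  · exact absurd (a3.trans a4.symm) (b2 _ _ a1 a2)
  · exact absurd (b3.trans b4.symm) (a2 _ _ b1 b2)
  · omega

theorem srpt_iff {n : ℕ} {a : ℕ → ℕ} {k : ℕ} : srpt (mkSeq (n+1) a) = k ↔ Srp n a k :=
  ⟨fun h => h ▸ srp_srpt n a, fun h => srp_unique (srp_srpt n a) h⟩

theorem last_mk {n : ℕ} {a : ℕ → ℕ} : lastEntry (mkSeq (n+1) a) = a n := by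
  simp [lastEntry, mkSeq]

theorem initial_id {N k : ℕ} {a : ℕ → ℕ} (h1 : ∀ i < N, a i ≤ i)
    (h2 : ∀ i j, i < j → j < N → a i = a j → k ≤ a i) : ∀ i, i ≤ k → i < N → a i = i := by
  intro i
  induction i using Nat.strong_induction_on with
  | _ i ih =>
    intro hk hN
    by_contra hne
    have h3 := h1 i hN
    have h4 : a i < i := by omega
    have h5 := ih (a i) h4 (by omega) (by omega)
    have := h2 (a i) i h4 hN h5
    omega

theorem finite_inv (n : ℕ) : (InvSeq0012 n).Finite := by
  refine Set.Finite.subset (Set.finite_Iic (fun _ : Fin n => n)) ?_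
  intro e he i
  exact (he.1 i).trans i.2.le

theorem ncard_fiber {α : Type*} (U : Set α) (hU : U.Finite) (g : α → ℕ) (s : Finset ℕ) :
    ∑ c ∈ s, Set.ncard {x | x ∈ U ∧ g x = c} = Set.ncard {x | x ∈ U ∧ g x ∈ s} := by
  classical
  induction s using Finset.induction_on with
  | empty => simp
  | insert c s hc ih =>
    rw [Finset.sum_insert hc, ih, ← Set.ncard_union_eq ?_ (hU.subset fun x hx => hx.1)
      (hU.subset fun x hx => hx.1)]
    · congr 1
      ext x
      simp only [Set.mem_union, Set.mem_setOf_eq, Finset.mem_insert]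
      tauto
    · rw [Set.disjoint_left]
      rintro x ⟨_, h1⟩ ⟨_, h2⟩
      exact hc (h1 ▸ h2)

/-- Insert `k` just before the last entry and make `l` the last one. -/
def insA (m k l : ℕ) (a : ℕ → ℕ) : ℕ → ℕ := fun i => if i < m then a i else if i = m then k else l

/-- Append `l`. -/
def appA (m l : ℕ) (a : ℕ → ℕ) : ℕ → ℕ := fun i => if i < m + 1 then a i else l

/-- `insA` on finite sequences. -/
def insF (m k l : ℕ) (e : Fin (m+1) → ℕ) : Fin (m+2) → ℕ :=
  mkSeq (m+2) (insA m k l fun i => if h : i < m + 1 then e ⟨i, h⟩ else 0)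

/-- `appA` on finite sequences. -/
def appF (m l : ℕ) (e : Fin (m+1) → ℕ) : Fin (m+2) → ℕ :=
  mkSeq (m+2) (appA m l fun i => if h : i < m + 1 then e ⟨i, h⟩ else 0)

theorem insF_mk (m k l : ℕ) (a : ℕ → ℕ) :
    insF m k l (mkSeq (m+1) a) = mkSeq (m+2) (insA m k l a) := by
  unfold insF
  rw [mkSeq_congr]
  intro i hi
  simp only [insA, mkSeq]
  split_ifs <;> first | rfl | omega

theorem appF_mk (m l : ℕ) (a : ℕ → ℕ) :
    appF m l (mkSeq (m+1) a) = mkSeq (m+2) (appA m l a) := by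
  unfold appF
  rw [mkSeq_congr]
  intro i hi
  simp only [appA, mkSeq]
  split_ifs <;> rfl

theorem ins_fwd {m k k' l : ℕ} {a : ℕ → ℕ} (hkl : k < l) (hl : l ≤ m) (hg : Good (m+1) a)
    (hs : Srp m a k') (hk : k ≤ k') (hm : a m = l) :
    Good (m+2) (insA m k l a) ∧ Srp (m+1) (insA m k l a) k := by
  have hp := initial_id hg.1 hs.2 k hk (by omega)
  obtain ⟨g1, g2⟩ := hg
  obtain ⟨s1, s2⟩ := hs
  have v1 : ∀ i, i < m → insA m k l a i = a i := fun i hi => by simp [insA, hi]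
  have v2 : insA m k l a m = k := by simp [insA]
  have v3 : insA m k l a (m+1) = l := by simp [insA]
  generalize insA m k l a = b at *
  have hmin : ∀ i j, i < j → j < m + 2 → b i = b j → k ≤ b i := by
    intro i j hij hj e
    by_cases hi : i = m
    · subst hi; omega
    have hi' : i < m := by omega
    by_cases hj1 : j < m
    · rw [v1 i hi', v1 j hj1] at e
      have := s2 i j hij (by omega) e
      rw [v1 i hi']; omega
    · by_cases hj2 : j = m
      · subst hj2; omega
      · obtain rfl : j = m + 1 := by omega
        omega
  refine ⟨⟨?_, ?_⟩, Or.inl ⟨k, m, by omega, by omega, ?_, v2⟩, hmin⟩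
  · intro i hi
    by_cases h1 : i < m
    · rw [v1 i h1]; exact g1 i (by omega)
    · by_cases h2 : i = m
      · subst h2; omega
      · obtain rfl : i = m + 1 := by omega
        omega
  · intro i j p q hij hjp hpq hq e1 e2 e3
    have hmn := hmin i j hij (by omega) e1
    have wi := v1 i (by omega)
    have wj := v1 j (by omega)
    have hpm : p ≠ m := by rintro rfl; omega
    have wp := v1 p (by omega)
    have hqm : q ≠ m := by rintro rfl; omega
    by_cases hq1 : q < m
    · have wq := v1 q hq1
      exact g2 i j p q hij hjp hpq (by omega) (by omega) (by omega) (by omega)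
    · obtain rfl : q = m + 1 := by omega
      exact g2 i j p m hij hjp (by omega) (by omega) (by omega) (by omega) (by omega)
  · rw [v1 k (by omega)]; exact hp

theorem ins_bwd {m k l : ℕ} {b : ℕ → ℕ} (hkl : k < l) (hl : l ≤ m) (hg : Good (m+2) b)
    (hs : Srp (m+1) b k) (hm : b m = k) (hm1 : b (m+1) = l) :
    ∃ a k', Good (m+1) a ∧ Srp m a k' ∧ k ≤ k' ∧ k' ≤ l ∧ a m = l ∧
      mkSeq (m+2) (insA m k l a) = mkSeq (m+2) b := by
  obtain ⟨g1, g2⟩ := hg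
  obtain ⟨s1, s2⟩ := hs
  obtain ⟨a, ha⟩ : ∃ a : ℕ → ℕ, a = fun i => if i < m then b i else l := ⟨_, rfl⟩
  have v1 : ∀ i, i < m → a i = b i := fun i hi => by simp [ha, hi]
  have v2 : a m = l := by simp [ha]
  have G1 : ∀ i < m + 1, a i ≤ i := by
    intro i hi
    by_cases h1 : i < m
    · rw [v1 i h1]; exact g1 i (by omega)
    · obtain rfl : i = m := by omega
      omega
  have hS := srp_srpt m a
  refine ⟨a, _, ⟨G1, ?_⟩, hS, ?_, ?_, v2, ?_⟩
  · intro i j p q hij hjp hpq hq e1 e2 e3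
    have wi := v1 i (by omega)
    have wj := v1 j (by omega)
    have wp := v1 p (by omega)
    by_cases hq1 : q < m
    · have wq := v1 q hq1
      exact g2 i j p q hij hjp hpq (by omega) (by omega) (by omega) (by omega)
    · obtain rfl : q = m := by omega
      exact g2 i j p (q+1) hij hjp (by omega) (by omega) (by omega) (by omega) (by omega)
  · rcases hS.1 with ⟨i, j, hij, hj, e1, e2⟩ | ⟨e, _⟩
    · rw [← e1]
      have wi := v1 i (by omega)
      by_cases hj1 : j < m
      · have wj := v1 j hj1
        have := s2 i j hij (by omega) (by omega)
        omega
      · obtain rfl : j = m := by omega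
        omega
    · omega
  · by_contra hlt
    push Not at hlt
    have hp := initial_id G1 hS.2
    by_cases hlm : l = m
    · rcases hS.1 with ⟨i, j, hij, hj, e1, e2⟩ | ⟨e, _⟩
      · have := G1 i (by omega)
        omega
      · omega
    · have h1 := hp l hlt.le (by omega)
      have := hS.2 l m (by omega) (by omega) (by omega)
      omega
  · rw [mkSeq_congr]
    intro i hi
    simp only [insA]
    split_ifs with h1 h2
    · exact v1 i h1
    · subst h2; omega
    · obtain rfl : i = m + 1 := by omega
      omega

theorem app_fwd {m k l : ℕ} {a : ℕ → ℕ} (hkl : k < l) (hl : l ≤ m) (hg : Good (m+1) a)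
    (hs : Srp m a k) (hm : l ≤ a m) :
    Good (m+2) (appA m l a) ∧ Srp (m+1) (appA m l a) k := by
  obtain ⟨g1, g2⟩ := hg
  obtain ⟨s1, s2⟩ := hs
  have v1 : ∀ i, i < m + 1 → appA m l a i = a i := fun i hi => by simp [appA, hi]
  have v3 : appA m l a (m+1) = l := by simp [appA]
  generalize appA m l a = b at *
  refine ⟨⟨?_, ?_⟩, ?_, ?_⟩
  · intro i hi
    by_cases h1 : i < m + 1
    · rw [v1 i h1]; exact g1 i (by omega)
    · obtain rfl : i = m + 1 := by omega
      omega
  · intro i j p q hij hjp hpq hq e1 e2 e3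
    have wi := v1 i (by omega)
    have wj := v1 j (by omega)
    have wp := v1 p (by omega)
    by_cases hq1 : q < m + 1
    · have wq := v1 q hq1
      exact g2 i j p q hij hjp hpq (by omega) (by omega) (by omega) (by omega)
    · obtain rfl : q = m + 1 := by omega
      have hpm : p ≠ m := by rintro rfl; omega
      exact g2 i j p m hij hjp (by omega) (by omega) (by omega) (by omega) (by omega)
  · rcases s1 with ⟨i, j, hij, hj, e1, e2⟩ | ⟨e, _⟩
    · exact Or.inl ⟨i, j, hij, by omega, by rw [v1 i (by omega), e1], by rw [v1 j hj, e2]⟩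
    · omega
  · intro i j hij hj e
    have wi := v1 i (by omega)
    by_cases hj1 : j < m + 1
    · have wj := v1 j hj1
      have := s2 i j hij hj1 (by omega)
      omega
    · obtain rfl : j = m + 1 := by omega
      omega

theorem app_bwd {m k l : ℕ} {b : ℕ → ℕ} (hkl : k < l) (hl : l ≤ m) (hg : Good (m+2) b)
    (hs : Srp (m+1) b k) (hm : b m ≠ k) (hm1 : b (m+1) = l) :
    Good (m+1) b ∧ Srp m b k ∧ l ≤ b m ∧ mkSeq (m+2) (appA m l b) = mkSeq (m+2) b := by
  have hp := initial_id hg.1 hs.2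
  obtain ⟨g1, g2⟩ := hg
  obtain ⟨s1, s2⟩ := hs
  obtain ⟨i, j, hij, hj, e1, e2⟩ : ∃ i j, i < j ∧ j < m + 1 ∧ b i = k ∧ b j = k := by
    rcases s1 with ⟨i, j, hij, hj, e1, e2⟩ | ⟨e, _⟩
    · refine ⟨i, j, hij, ?_, e1, e2⟩
      by_contra h
      obtain rfl : j = m + 1 := by omega
      omega
    · omega
  have hjm : j ≠ m := by rintro rfl; omega
  refine ⟨⟨fun i hi => g1 i (by omega), fun i j p q a1 a2 a3 a4 => g2 i j p q a1 a2 a3 (by omega)⟩,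
    ⟨Or.inl ⟨i, j, hij, hj, e1, e2⟩, fun i j a1 a2 => s2 i j a1 (by omega)⟩, ?_, ?_⟩
  · by_contra hlt
    by_cases hk : k < b m
    · exact g2 i j m (m+1) hij (by omega) (by omega) (by omega) (by omega) (by omega) (by omega)
    · have := hp (b m) (by omega) (by omega)
      have := s2 (b m) m (by omega) (by omega) this
      omega
  · rw [mkSeq_congr]
    intro i hi
    simp only [appA]
    split_ifs with h1
    · rfl
    · obtain rfl : i = m + 1 := by omega
      omega

theorem stmt11_aux (m k l : ℕ) (hkl : k < l) (hl : l ≤ m) :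
    f (m+2) k l = ∑ k' ∈ Finset.Icc k l, f (m+1) k' l + ∑ l' ∈ Finset.Icc l m, f (m+1) k l' := by
  have h1 : ∑ k' ∈ Finset.Icc k l, f (m+1) k' l =
      Set.ncard {e | e ∈ {e : Fin (m+1) → ℕ | e ∈ InvSeq0012 (m+1) ∧ lastEntry e = l} ∧
        srpt e ∈ Finset.Icc k l} := by
    rw [← ncard_fiber _ ((finite_inv (m+1)).subset fun x hx => hx.1)]
    refine Finset.sum_congr rfl fun c _ => ?_
    unfold f
    congr 1
    ext e
    simp only [Set.mem_setOf_eq]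
    tauto
  have h2 : ∑ l' ∈ Finset.Icc l m, f (m+1) k l' =
      Set.ncard {e | e ∈ {e : Fin (m+1) → ℕ | e ∈ InvSeq0012 (m+1) ∧ srpt e = k} ∧
        lastEntry e ∈ Finset.Icc l m} := by
    rw [← ncard_fiber _ ((finite_inv (m+1)).subset fun x hx => hx.1)]
    refine Finset.sum_congr rfl fun c _ => ?_
    unfold f
    congr 1
    ext e
    simp only [Set.mem_setOf_eq]
    tauto
  rw [h1, h2]
  set T1 := {e | e ∈ {e : Fin (m+1) → ℕ | e ∈ InvSeq0012 (m+1) ∧ lastEntry e = l} ∧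
        srpt e ∈ Finset.Icc k l} with hT1
  set T2 := {e | e ∈ {e : Fin (m+1) → ℕ | e ∈ InvSeq0012 (m+1) ∧ srpt e = k} ∧
        lastEntry e ∈ Finset.Icc l m} with hT2
  have f1 : T1.Finite := (finite_inv (m+1)).subset fun x hx => hx.1.1
  have f2 : T2.Finite := (finite_inv (m+1)).subset fun x hx => hx.1.1
  have m1 : ∀ a, mkSeq (m+1) a ∈ T1 ↔ (Good (m+1) a ∧ a m = l) ∧ ∃ k', Srp m a k' ∧ k ≤ k' ∧ k' ≤ l := by
    intro a
    simp only [hT1, Set.mem_setOf_eq, good_iff, last_mk, Finset.mem_Icc]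
    refine and_congr_right fun _ => ⟨fun h => ⟨_, srp_srpt m a, h⟩, ?_⟩
    rintro ⟨k', h, h'⟩
    rw [srpt_iff.2 h]; exact h'
  have m2 : ∀ a, mkSeq (m+1) a ∈ T2 ↔ (Good (m+1) a ∧ Srp m a k) ∧ l ≤ a m ∧ a m ≤ m := by
    intro a
    simp only [hT2, Set.mem_setOf_eq, good_iff, last_mk, Finset.mem_Icc, srpt_iff]
  have i1 : Set.InjOn (insF m k l) T1 := by
    intro e he e' he' h
    obtain ⟨a, rfl⟩ := exists_mkSeq e
    obtain ⟨b, rfl⟩ := exists_mkSeq e'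
    rw [insF_mk, insF_mk, mkSeq_congr] at h
    rw [m1] at he he'
    rw [mkSeq_congr]
    intro i hi
    by_cases him : i < m
    · have := h i (by omega)
      simpa [insA, him] using this
    · obtain rfl : i = m := by omega
      rw [he.1.2, he'.1.2]
  have i2 : Set.InjOn (appF m l) T2 := by
    intro e he e' he' h
    obtain ⟨a, rfl⟩ := exists_mkSeq e
    obtain ⟨b, rfl⟩ := exists_mkSeq e'
    rw [appF_mk, appF_mk, mkSeq_congr] at h
    rw [mkSeq_congr]
    intro i hi
    have := h i (by omega)
    simpa [appA, hi] using this
  rw [← Set.ncard_image_of_injOn i1, ← Set.ncard_image_of_injOn i2,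
    ← Set.ncard_union_eq ?_ (f1.image _) (f2.image _)]
  · unfold f
    congr 1
    ext e
    obtain ⟨b, rfl⟩ := exists_mkSeq e
    simp only [Set.mem_setOf_eq, good_iff, srpt_iff, last_mk, Set.mem_union, Set.mem_image]
    constructor
    · rintro ⟨hg, hs, hm1⟩
      by_cases hm : b m = k
      · left
        obtain ⟨a, k', q1, q2, q3, q4, q5, q6⟩ := ins_bwd hkl hl hg hs hm hm1
        exact ⟨mkSeq (m+1) a, (m1 a).2 ⟨⟨q1, q5⟩, k', q2, q3, q4⟩, by rw [insF_mk, q6]⟩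
      · right
        obtain ⟨q1, q2, q3, q4⟩ := app_bwd hkl hl hg hs hm hm1
        exact ⟨mkSeq (m+1) b, (m2 b).2 ⟨⟨q1, q2⟩, q3, q1.1 m (by omega)⟩, by rw [appF_mk, q4]⟩
    · rw [← good_iff, ← srpt_iff, ← last_mk (n := m + 1) (a := b)]
      rintro (⟨e, he, h⟩ | ⟨e, he, h⟩)
      · obtain ⟨a, rfl⟩ := exists_mkSeq e
        obtain ⟨⟨q1, q2⟩, k', q3, q4, q5⟩ := (m1 a).1 he
        obtain ⟨r1, r2⟩ := ins_fwd hkl hl q1 q3 q4 q2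
        rw [← h, insF_mk, good_iff, srpt_iff, last_mk]
        exact ⟨r1, r2, by simp [insA]⟩
      · obtain ⟨a, rfl⟩ := exists_mkSeq e
        obtain ⟨⟨q1, q2⟩, q3, q4⟩ := (m2 a).1 he
        obtain ⟨r1, r2⟩ := app_fwd hkl hl q1 q2 q3
        rw [← h, appF_mk, good_iff, srpt_iff, last_mk]
        exact ⟨r1, r2, by simp [appA]⟩
  · rw [Set.disjoint_left]
    rintro _ ⟨e, he, rfl⟩ ⟨e', he', h⟩
    obtain ⟨a, rfl⟩ := exists_mkSeq e
    obtain ⟨b, rfl⟩ := exists_mkSeq e'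
    rw [insF_mk, appF_mk, mkSeq_congr] at h
    have h3 := h m (by omega)
    have h4 := ((m2 b).1 he').2.1
    simp [insA, appA] at h3
    omega

/-- For `n ≥ 2` and `0 ≤ k < ℓ ≤ n - 2`,
`f n k ℓ = ∑_{k'=k}^{ℓ} f (n-1) k' ℓ + ∑_{ℓ'=ℓ}^{n-2} f (n-1) k ℓ'`. -/
theorem stmt11 (n k ℓ : ℕ) (hn : 2 ≤ n) (hkℓ : k < ℓ) (hℓ : ℓ + 2 ≤ n) :
    f n k ℓ =
      ∑ k' ∈ Finset.Icc k ℓ, f (n - 1) k' ℓ +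
        ∑ ℓ' ∈ Finset.Icc ℓ (n - 2), f (n - 1) k ℓ' := by
  obtain ⟨m, rfl⟩ : ∃ m, n = m + 2 := ⟨n - 2, by omega⟩
  exact stmt11_aux m k ℓ hkℓ (by omega)
end
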